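/- arXiv:2202.12106 — 18 statements merged into one kernel-verified Lean document; each statement's English description precedes it below -/
import Mathlib

section
/- Let (X, ≼) be a preordered space and let I be an infinite set. Then there exists a multi-utility for ≼ indexed by I if and only if there exists a family (A_i)_{i∈I} of increasing subsets of X such that for all x, y ∈ X with x ≺ y the family separates x from y (i.e., there is i ∈ I with x ∉ A_i and y ∈ A_i), and for all x, y ∈ X with x ⋈ y the family separates both x from y and y from x. -/
/-- A family `(v i)_{i ∈ I}` of real-valued functions is a multi-utility for the
preorder on `X` if `x ≼ y ↔ ∀ i, v i x ≤ v i y`. -/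
def IsMultiUtility {X I : Type*} [Preorder X] (v : I → X → ℝ) : Prop :=
  ∀ x y : X, x ≤ y ↔ ∀ i, v i x ≤ v i y

/-- A subset `A ⊆ X` is increasing if `x ∈ A` and `x ≼ y` imply `y ∈ A`. -/
def IsIncreasingSet {X : Type*} [Preorder X] (A : Set X) : Prop :=
  ∀ x ∈ A, ∀ y, x ≤ y → y ∈ A

/-- `x ⋈ y`: `x` and `y` are incomparable. -/
def Incomp {X : Type*} [Preorder X] (x y : X) : Prop :=
  ¬ x ≤ y ∧ ¬ y ≤ x

/-- For an infinite set `I`, a preordered space has a multi-utility indexed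
by `I` iff there is a family `(A i)_{i ∈ I}` of increasing sets separating `x` from `y`
whenever `x ≺ y`, and separating both `x` from `y` and `y` from `x` whenever `x ⋈ y`. -/
theorem stmt_0 {X : Type*} [Preorder X] {I : Type*} [Infinite I] :
    (∃ v : I → X → ℝ, IsMultiUtility v) ↔
      ∃ A : I → Set X, (∀ i, IsIncreasingSet (A i)) ∧
        (∀ x y : X, x < y → ∃ i, x ∉ A i ∧ y ∈ A i) ∧
        (∀ x y : X, Incomp x y →
          (∃ i, x ∉ A i ∧ y ∈ A i) ∧ (∃ i, y ∉ A i ∧ x ∈ A i)) := by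
  have key : Nonempty (I ≃ I × ℚ) := by
    rw [← Cardinal.lift_mk_eq']
    simp
  classical
  constructor
  · rintro ⟨v, hv⟩
    obtain ⟨e⟩ := key
    have sep : ∀ x y : X, ¬ y ≤ x →
        ∃ i, x ∉ {z | (((e i).2 : ℚ) : ℝ) < v (e i).1 z} ∧
          y ∈ {z | (((e i).2 : ℚ) : ℝ) < v (e i).1 z} := by
      intro x y h
      rw [hv y x] at h
      push Not at h
      obtain ⟨i, hi⟩ := h
      obtain ⟨q, hq1, hq2⟩ := exists_rat_btwn hi
      refine ⟨e.symm (i, q), ?_, ?_⟩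
      · simpa using hq1.le
      · simpa using hq2
    refine ⟨fun i => {z | (((e i).2 : ℚ) : ℝ) < v (e i).1 z}, ?_, ?_, ?_⟩
    · intro i x hx y hxy
      exact lt_of_lt_of_le hx ((hv x y).1 hxy _)
    · intro x y h
      exact sep x y (not_le_of_gt h)
    · intro x y h
      exact ⟨sep x y h.2, sep y x h.1⟩
  · rintro ⟨A, hA, h1, h2⟩
    refine ⟨fun i x => if x ∈ A i then 1 else 0, ?_⟩
    intro x y
    constructor
    · intro h i
      by_cases hx : x ∈ A i
      · simp [hx, hA i x hx y h]
      · by_cases hy : y ∈ A i <;> simp [hx, hy]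
    · intro h
      by_contra hxy
      have : ∃ i, y ∉ A i ∧ x ∈ A i := by
        by_cases hyx : y ≤ x
        · exact h1 y x (lt_of_le_not_ge hyx hxy)
        · exact (h2 x y ⟨hxy, hyx⟩).2
      obtain ⟨i, hy, hx⟩ := this
      have := h i
      simp [hx, hy] at this
      linarith
end

section
/- Let (X, ≼) be a preordered space. Then there exists a strict monotone for ≼ if and only if there exists a countable family (A_n)_{n∈ℕ} of increasing subsets of X such that for all x, y ∈ X with x ≺ y there exists n with x ∉ A_n and y ∈ A_n. -/
/-- `f` is a monotone: `x ≼ y` implies `f x ≤ f y`. -/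
def IsMonotoneFn {X : Type*} [Preorder X] (f : X → ℝ) : Prop :=
  ∀ x y : X, x ≤ y → f x ≤ f y

/-- `f` is a strict monotone: a monotone such that `x ≺ y` implies `f x < f y`. -/
def IsStrictMonotoneFn {X : Type*} [Preorder X] (f : X → ℝ) : Prop :=
  IsMonotoneFn f ∧ ∀ x y : X, x < y → f x < f y

/-- A preordered space admits a strict monotone iff there is a countable
family `(A n)_{n ∈ ℕ}` of increasing subsets separating `x` from `y` whenever `x ≺ y`. -/
theorem stmt_1 {X : Type*} [Preorder X] :
    (∃ f : X → ℝ, IsStrictMonotoneFn f) ↔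
      ∃ A : ℕ → Set X, (∀ n, IsIncreasingSet (A n)) ∧
        ∀ x y : X, x < y → ∃ n, x ∉ A n ∧ y ∈ A n := by
  constructor
  · rintro ⟨f, hm, hs⟩
    obtain ⟨e, he⟩ := exists_surjective_nat ℚ
    refine ⟨fun n => {x | ((e n : ℚ) : ℝ) < f x}, ?_, ?_⟩
    · intro n x hx y hxy
      exact lt_of_lt_of_le hx (hm x y hxy)
    · intro x y hxy
      obtain ⟨q, hq1, hq2⟩ := exists_rat_btwn (hs x y hxy)
      obtain ⟨n, rfl⟩ := he q
      exact ⟨n, not_lt.mpr hq1.le, hq2⟩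
  · rintro ⟨A, hA, hsep⟩
    let g : X → ℕ → ℝ := fun x n => (A n).indicator (fun _ => ((1 : ℝ) / 2) ^ n) x
    have hsum : ∀ x, Summable (g x) := by
      intro x
      refine Summable.of_nonneg_of_le (fun n => ?_) (fun n => ?_) summable_geometric_two
      · exact Set.indicator_nonneg (fun _ _ => by positivity) x
      · exact Set.indicator_le_self' (fun _ _ => by positivity) x
    have hle : ∀ x y, x ≤ y → ∀ n, g x n ≤ g y n := by
      intro x y hxy n
      by_cases hx : x ∈ A n
      · have hy := hA n x hx y hxy
        simp [g, hx, hy]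
      · simp only [g, Set.indicator_of_notMem hx]
        exact Set.indicator_nonneg (fun _ _ => by positivity) y
    refine ⟨fun x => ∑' n, g x n, ?_, ?_⟩
    · intro x y hxy
      exact (hsum x).tsum_le_tsum (hle x y hxy) (hsum y)
    · intro x y hxy
      obtain ⟨n, hx, hy⟩ := hsep x y hxy
      refine Summable.tsum_lt_tsum (i := n) (hle x y hxy.le) ?_ (hsum x) (hsum y)
      simp [g, hx, hy]
end

section
/- Let (X, ≼) be a preordered space. Then there exists an injective monotone for ≼ if and only if there exists a countable family (A_n)_{n∈ℕ} of increasing subsets of X such that for all x, y ∈ X with x ≺ y there exists n with x ∉ A_n and y ∈ A_n, and for all x, y ∈ X with x ⋈ y there exists n with either (x ∉ A_n and y ∈ A_n) or (y ∉ A_n and x ∈ A_n). -/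
/-- `f` is an injective monotone: a monotone such that `f x = f y` implies `x ∼ y`. -/
def IsInjectiveMonotoneFn {X : Type*} [Preorder X] (f : X → ℝ) : Prop :=
  IsMonotoneFn f ∧ ∀ x y : X, f x = f y → x ≤ y ∧ y ≤ x

/-- A preordered space admits an injective monotone iff there is a countable
family `(A n)_{n ∈ ℕ}` of increasing subsets separating `x` from `y` whenever `x ≺ y`,
and separating `x` from `y` or `y` from `x` whenever `x ⋈ y`. -/
theorem stmt_2 {X : Type*} [Preorder X] :
    (∃ f : X → ℝ, IsInjectiveMonotoneFn f) ↔
      ∃ A : ℕ → Set X, (∀ n, IsIncreasingSet (A n)) ∧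
        (∀ x y : X, x < y → ∃ n, x ∉ A n ∧ y ∈ A n) ∧
        (∀ x y : X, Incomp x y →
          ∃ n, (x ∉ A n ∧ y ∈ A n) ∨ (y ∉ A n ∧ x ∈ A n)) := by
  classical
  constructor
  · rintro ⟨f, hm, hi⟩
    obtain ⟨q, hq⟩ := exists_surjective_nat ℚ
    have key : ∀ x y : X, f x < f y →
        ∃ n, x ∉ {z | ((q n : ℚ) : ℝ) < f z} ∧ y ∈ {z | ((q n : ℚ) : ℝ) < f z} := by
      intro x y h
      obtain ⟨r, h1, h2⟩ := exists_rat_btwn h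
      obtain ⟨n, rfl⟩ := hq r
      exact ⟨n, not_lt.mpr h1.le, h2⟩
    refine ⟨fun n => {z | ((q n : ℚ) : ℝ) < f z}, ?_, ?_, ?_⟩
    · intro n x hx y hxy
      exact lt_of_lt_of_le hx (hm x y hxy)
    · intro x y h
      exact key x y (lt_of_le_of_ne (hm x y h.le) fun e => h.not_ge (hi x y e).2)
    · intro x y h
      rcases lt_trichotomy (f x) (f y) with h1 | h1 | h1
      · obtain ⟨n, hn⟩ := key x y h1
        exact ⟨n, Or.inl hn⟩
      · exact absurd (hi x y h1).1 h.1
      · obtain ⟨n, hn⟩ := key y x h1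
        exact ⟨n, Or.inr hn⟩
  · rintro ⟨A, hA, hlt, hinc⟩
    refine ⟨fun x => Cardinal.cantorFunction (1 / 3) fun n => decide (x ∈ A n), ?_, ?_⟩
    · intro x y h
      refine Cardinal.cantorFunction_le (by norm_num) (by norm_num) fun n hn => ?_
      simp only [decide_eq_true_eq] at hn ⊢
      exact hA n x hn y h
    · intro x y h
      have h2 := Cardinal.cantorFunction_injective (by norm_num) (by norm_num) h
      have h3 : ∀ n, x ∈ A n ↔ y ∈ A n := fun n => by
        simpa using congrFun h2 n
      by_contra hc
      by_cases h4 : x ≤ y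
      · obtain ⟨n, hn⟩ := hlt x y (lt_of_le_not_ge h4 fun h5 => hc ⟨h4, h5⟩)
        exact hn.1 ((h3 n).2 hn.2)
      · by_cases h5 : y ≤ x
        · obtain ⟨n, hn⟩ := hlt y x (lt_of_le_not_ge h5 h4)
          exact hn.1 ((h3 n).1 hn.2)
        · obtain ⟨n, hn | hn⟩ := hinc x y ⟨h4, h5⟩
          · exact hn.1 ((h3 n).2 hn.2)
          · exact hn.1 ((h3 n).1 hn.2)
end

section
/- Let (X, ≼) be a preordered space and let I be an infinite set. The following are equivalent: (i) there exists a strict monotone multi-utility for ≼ indexed by I; (ii) there exist both a strict monotone for ≼ and a multi-utility for ≼ indexed by I; (iii) there exists a family (A_i)_{i∈I} of increasing subsets of X which, for all x, y ∈ X with x ⋈ y, separates x from y (i.e., there is i with x ∉ A_i and y ∈ A_i), together with a countable subset I' ⊆ I such that (A_i)_{i∈I'} separates x from y whenever x ≺ y. -/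
theorem aux_equiv (I : Type*) [Infinite I] : Nonempty (Option I × ℚ ≃ I) := by
  rw [← Cardinal.eq]
  have h : Cardinal.aleph0 ≤ Cardinal.mk I := Cardinal.aleph0_le_mk I
  simp only [Cardinal.mk_prod, Cardinal.mk_option, Cardinal.mk_eq_aleph0 ℚ, Cardinal.lift_aleph0,
    Cardinal.lift_uzero]
  rw [Cardinal.add_one_of_aleph0_le h, Cardinal.mul_aleph0_eq h]

theorem aux_i {X : Type*} [Preorder X] {I : Type*} [Infinite I] {f : X → ℝ}
    (hf : IsStrictMonotoneFn f) {v : I → X → ℝ} (hv : IsMultiUtility v) :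
    ∃ v : I → X → ℝ, IsMultiUtility v ∧ ∀ i, IsStrictMonotoneFn (v i) := by
  obtain ⟨e'⟩ : Nonempty (I × ℕ ≃ I) := by
    rw [← Cardinal.eq]
    have h : Cardinal.aleph0 ≤ Cardinal.mk I := Cardinal.aleph0_le_mk I
    simp only [Cardinal.mk_prod, Cardinal.mk_nat, Cardinal.lift_aleph0, Cardinal.lift_uzero]
    rw [Cardinal.mul_aleph0_eq h]
  let w : I × ℕ → X → ℝ := fun p x => v p.1 x + (1 / ((p.2 : ℝ) + 1)) * f x
  have hpos : ∀ n : ℕ, 0 < 1 / ((n : ℝ) + 1) := fun n => by positivity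
  have hmono : ∀ p, IsStrictMonotoneFn (w p) := by
    intro p
    refine ⟨fun x y h => ?_, fun x y h => ?_⟩
    · exact add_le_add ((hv x y).1 h p.1) (mul_le_mul_of_nonneg_left (hf.1 x y h) (hpos _).le)
    · exact add_lt_add_of_le_of_lt ((hv x y).1 h.le p.1)
        (mul_lt_mul_of_pos_left (hf.2 x y h) (hpos _))
  refine ⟨fun i => w (e'.symm i), fun x y => ⟨fun h i => (hmono _).1 x y h, fun h => ?_⟩,
    fun i => hmono _⟩
  rw [hv]
  intro i
  have h2 : ∀ n : ℕ, v i x + (1 / ((n : ℝ) + 1)) * f x ≤ v i y + (1 / ((n : ℝ) + 1)) * f y := by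
    intro n
    have := h (e' (i, n))
    simpa only [Equiv.symm_apply_apply, w] using this
  have ht := tendsto_one_div_add_atTop_nhds_zero_nat (𝕜 := ℝ)
  have hx := (ht.mul_const (f x)).const_add (v i x)
  have hy := (ht.mul_const (f y)).const_add (v i y)
  have := le_of_tendsto_of_tendsto' hx hy h2
  simpa using this

theorem aux_iii {X : Type*} [Preorder X] {I : Type*} [Infinite I] {f : X → ℝ}
    (hf : IsStrictMonotoneFn f) {v : I → X → ℝ} (hv : IsMultiUtility v) :
    ∃ A : I → Set X, (∀ i, IsIncreasingSet (A i)) ∧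
        (∀ x y : X, Incomp x y → ∃ i, x ∉ A i ∧ y ∈ A i) ∧
        ∃ I' : Set I, I'.Countable ∧
          ∀ x y : X, x < y → ∃ i ∈ I', x ∉ A i ∧ y ∈ A i := by
  obtain ⟨e⟩ := aux_equiv I
  let u : Option I → X → ℝ := fun o => o.elim f v
  have hu : ∀ o x y, x ≤ y → u o x ≤ u o y := by
    intro o x y h
    cases o with
    | none => exact hf.1 x y h
    | some i => exact (hv x y).1 h i
  let A : I → Set X := fun i => {x | (((e.symm i).2 : ℚ) : ℝ) < u (e.symm i).1 x}
  have key : ∀ o x y, u o x < u o y → ∃ q : ℚ, x ∉ A (e (o, q)) ∧ y ∈ A (e (o, q)) := by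
    intro o x y h
    obtain ⟨q, h1, h2⟩ := exists_rat_btwn h
    refine ⟨q, ?_, ?_⟩
    · simp only [A, Equiv.symm_apply_apply, Set.mem_ofPred_eq, not_lt]
      exact h1.le
    · simp only [A, Equiv.symm_apply_apply, Set.mem_ofPred_eq]
      exact h2
  refine ⟨A, fun i x hx y h => lt_of_lt_of_le hx (hu _ x y h), fun x y h => ?_,
    Set.range fun q : ℚ => e (none, q), Set.countable_range _, fun x y h => ?_⟩
  · have h2 := h.2
    rw [hv] at h2
    push Not at h2
    obtain ⟨i, hi⟩ := h2
    obtain ⟨q, hq⟩ := key (some i) x y hi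
    exact ⟨_, hq⟩
  · obtain ⟨q, hq⟩ := key none x y (hf.2 x y h)
    exact ⟨_, ⟨q, rfl⟩, hq⟩

theorem aux_ii {X : Type*} [Preorder X] {I : Type*} {A : I → Set X}
    (hA : ∀ i, IsIncreasingSet (A i))
    (hI : ∀ x y : X, Incomp x y → ∃ i, x ∉ A i ∧ y ∈ A i) {I' : Set I} (hc : I'.Countable)
    (hs : ∀ x y : X, x < y → ∃ i ∈ I', x ∉ A i ∧ y ∈ A i) :
    (∃ f : X → ℝ, IsStrictMonotoneFn f) ∧ ∃ v : I → X → ℝ, IsMultiUtility v := by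
  classical
  let v : I → X → ℝ := fun i x => if x ∈ A i then 1 else 0
  have v0 : ∀ i x, 0 ≤ v i x := fun i x => by dsimp only [v]; split_ifs <;> norm_num
  have v1 : ∀ i x, v i x ≤ 1 := fun i x => by dsimp only [v]; split_ifs <;> norm_num
  have vm : ∀ i x y, x ≤ y → v i x ≤ v i y := by
    intro i x y h
    by_cases hx : x ∈ A i
    · have hy := hA i x hx y h
      simp [v, hx, hy]
    · have : v i x = 0 := by simp [v, hx]
      rw [this]
      exact v0 i y
  have vs : ∀ i x y, x ∉ A i → y ∈ A i → v i x < v i y := by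
    intro i x y hx hy
    simp [v, hx, hy]
  refine ⟨?_, v, fun x y => ⟨fun h i => vm i x y h, fun h => ?_⟩⟩
  · haveI : Encodable I' := hc.toEncodable
    let c : I' → ℝ := fun i => (1 / 2 : ℝ) ^ Encodable.encode i
    have hcpos : ∀ i, 0 < c i := fun i => by positivity
    have hsum : ∀ x, Summable fun i : I' => c i * v i x := fun x =>
      Summable.of_nonneg_of_le (fun i => mul_nonneg (hcpos i).le (v0 _ _))
        (fun i => mul_le_of_le_one_right (hcpos i).le (v1 _ _)) summable_geometric_two_encode
    have hle : ∀ x y, x ≤ y → ∀ i : I', c i * v i x ≤ c i * v i y := fun x y h i =>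
      mul_le_mul_of_nonneg_left (vm _ x y h) (hcpos i).le
    refine ⟨fun x => ∑' i : I', c i * v i x, fun x y h => ?_, fun x y h => ?_⟩
    · exact (hsum x).tsum_le_tsum (hle x y h) (hsum y)
    · obtain ⟨i, hi, hx, hy⟩ := hs x y h
      exact Summable.tsum_lt_tsum (i := (⟨i, hi⟩ : I')) (hle x y h.le)
        (mul_lt_mul_of_pos_left (vs i x y hx hy) (hcpos _)) (hsum x) (hsum y)
  · by_contra hxy
    by_cases hyx : y ≤ x
    · obtain ⟨i, _, h1, h2⟩ := hs y x (lt_of_le_not_ge hyx hxy)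
      exact absurd (h i) (not_le.2 (vs i y x h1 h2))
    · obtain ⟨i, h1, h2⟩ := hI y x ⟨hyx, hxy⟩
      exact absurd (h i) (not_le.2 (vs i y x h1 h2))

/-- For an infinite set `I`, the following are equivalent:
(i) there is a strict monotone multi-utility indexed by `I`;
(ii) there are a strict monotone and a multi-utility indexed by `I`;
(iii) there is a family `(A i)_{i ∈ I}` of increasing sets separating `x` from `y`
whenever `x ⋈ y`, together with a countable `I' ⊆ I` such that `(A i)_{i ∈ I'}`
separates `x` from `y` whenever `x ≺ y`. -/
theorem stmt_3 {X : Type*} [Preorder X] {I : Type*} [Infinite I] :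
    ((∃ v : I → X → ℝ, IsMultiUtility v ∧ ∀ i, IsStrictMonotoneFn (v i)) ↔
      ((∃ f : X → ℝ, IsStrictMonotoneFn f) ∧ ∃ v : I → X → ℝ, IsMultiUtility v)) ∧
    (((∃ f : X → ℝ, IsStrictMonotoneFn f) ∧ ∃ v : I → X → ℝ, IsMultiUtility v) ↔
      (∃ A : I → Set X, (∀ i, IsIncreasingSet (A i)) ∧
        (∀ x y : X, Incomp x y → ∃ i, x ∉ A i ∧ y ∈ A i) ∧
        ∃ I' : Set I, I'.Countable ∧
          ∀ x y : X, x < y → ∃ i ∈ I', x ∉ A i ∧ y ∈ A i)) := by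
  refine ⟨⟨?_, ?_⟩, ⟨?_, ?_⟩⟩
  · rintro ⟨v, hv, hs⟩
    exact ⟨⟨v (Classical.arbitrary I), hs _⟩, v, hv⟩
  · rintro ⟨⟨f, hf⟩, v, hv⟩
    exact aux_i hf hv
  · rintro ⟨⟨f, hf⟩, v, hv⟩
    exact aux_iii hf hv
  · rintro ⟨A, hA, hI, I', hc, hs⟩
    exact aux_ii hA hI hc hs
end

section
/- There exists a preordered space (X, ≼) such that the quotient X/∼ has the cardinality of the continuum 𝔠, a strict monotone for ≼ exists, and no injective monotone for ≼ exists. -/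
/-- There is a preordered space whose quotient `X/∼` (the
antisymmetrization) has the cardinality of the continuum, which admits a strict
monotone but no injective monotone. -/
theorem stmt_4 : ∃ (X : Type) (_ : Preorder X),
    Cardinal.mk (Antisymmetrization X (· ≤ ·)) = Cardinal.continuum ∧
    (∃ f : X → ℝ, IsStrictMonotoneFn f) ∧
    ¬ ∃ f : X → ℝ, IsInjectiveMonotoneFn f := by
  let P : Preorder (ℝ × Bool) :=
    { le := fun a b => a = b ∨ a.1 < b.1
      lt := fun a b => (a = b ∨ a.1 < b.1) ∧ ¬ (b = a ∨ b.1 < a.1)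
      lt_iff_le_not_ge := fun _ _ => Iff.rfl
      le_refl := fun a => Or.inl rfl
      le_trans := by
        rintro a b c (rfl | h) (rfl | h')
        · exact Or.inl rfl
        · exact Or.inr h'
        · exact Or.inr h
        · exact Or.inr (h.trans h') }
  have hle : ∀ a b : ℝ × Bool, P.le a b ↔ (a = b ∨ a.1 < b.1) := fun a b => Iff.rfl
  have hanti : ∀ a b : ℝ × Bool, P.le a b → P.le b a → a = b := by
    intro a b h1 h2
    rcases (hle a b).1 h1 with h | h
    · exact h
    · rcases (hle b a).1 h2 with h' | h'
      · exact h'.symm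
      · exact absurd h (lt_asymm h')
  refine ⟨ℝ × Bool, P, ?_, ⟨fun a => a.1, ?_, ?_⟩, ?_⟩
  · have e : Function.Bijective
        (fun a : ℝ × Bool => @toAntisymmetrization (ℝ × Bool) P.le _ a) := by
      refine ⟨fun a b h => ?_, fun q => ?_⟩
      · have h2 := Quotient.exact h
        exact hanti a b h2.1 h2.2
      · obtain ⟨a, ha⟩ := Quotient.exists_rep q
        exact ⟨a, ha⟩
    refine (Cardinal.mk_congr (Equiv.ofBijective _ e)).symm.trans ?_
    rw [Cardinal.mk_prod, Cardinal.mk_real, Cardinal.mk_bool]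
    simp
  · intro x y h
    rcases (hle x y).1 h with rfl | h
    · exact le_rfl
    · exact h.le
  · intro x y h
    obtain ⟨h1, h2⟩ := (@lt_iff_le_not_ge _ P x y).1 h
    rcases (hle x y).1 h1 with rfl | h
    · exact absurd h1 h2
    · exact h
  · rintro ⟨f, hm, hi⟩
    have hne : ∀ x : ℝ, f (x, false) ≠ f (x, true) := by
      intro x h
      obtain ⟨h1, h2⟩ := hi _ _ h
      have := congrArg Prod.snd (hanti _ _ h1 h2)
      simp at this
    have hq : ∀ x : ℝ, ∃ q : ℚ, min (f (x, false)) (f (x, true)) < q ∧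
        (q : ℝ) < max (f (x, false)) (f (x, true)) :=
      fun x => exists_rat_btwn (min_lt_max.2 (hne x))
    choose q hq1 hq2 using hq
    have hmono : StrictMono q := by
      intro x y hxy
      have key : ∀ i j, f (x, i) ≤ f (y, j) := fun i j => hm _ _ ((hle _ _).2 (Or.inr hxy))
      have : max (f (x, false)) (f (x, true)) ≤ min (f (y, false)) (f (y, true)) :=
        max_le (le_min (key _ _) (key _ _)) (le_min (key _ _) (key _ _))
      exact_mod_cast ((hq2 x).trans_le this).trans (hq1 y)
    have hc : Countable ℝ := hmono.injective.countable
    exact Cardinal.not_countable_real (Set.countable_univ)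
end

section
/- There exists a preordered space (X, ≼) which admits a strict monotone multi-utility indexed by a set of cardinality 𝔠 (the cardinality of the continuum) but admits no injective monotone. -/
/-- Subsets of the reals, ordered by equality (an antichain of size `2 ^ 𝔠`). -/
structure DiscreteSubsets where
  carrier : Set ℝ

instance instPreorderDiscreteSubsets : Preorder DiscreteSubsets where
  le a b := a = b
  le_refl _ := rfl
  le_trans _ _ _ h k := Eq.trans h k

theorem DiscreteSubsets.le_iff (a b : DiscreteSubsets) : a ≤ b ↔ a = b := Iff.rfl

open Classical in
/-- Signed indicator functions of membership. -/
noncomputable def signedIndicator : ℝ ⊕ ℝ → DiscreteSubsets → ℝ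
  | Sum.inl r, A => if r ∈ A.carrier then 1 else 0
  | Sum.inr r, A => if r ∈ A.carrier then 0 else 1

/-- There is a preordered space which admits a strict monotone
multi-utility indexed by a set of cardinality 𝔠, but no injective monotone. -/
theorem stmt_5 : ∃ (X : Type) (_ : Preorder X),
    (∃ (I : Type) (v : I → X → ℝ), Cardinal.mk I = Cardinal.continuum ∧
      IsMultiUtility v ∧ ∀ i, IsStrictMonotoneFn (v i)) ∧
    ¬ ∃ f : X → ℝ, IsInjectiveMonotoneFn f := by
  refine ⟨DiscreteSubsets, instPreorderDiscreteSubsets,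
    ⟨ℝ ⊕ ℝ, signedIndicator, by simp [Cardinal.mk_real], ?_, ?_⟩, ?_⟩
  · intro x y
    constructor
    · intro h i
      rw [(DiscreteSubsets.le_iff x y).1 h]
    · intro h
      rw [DiscreteSubsets.le_iff]
      cases x with | mk A =>
      cases y with | mk B =>
      congr 1
      ext r
      have h1 := h (Sum.inl r)
      have h2 := h (Sum.inr r)
      by_cases hA : r ∈ A <;> by_cases hB : r ∈ B <;>
        simp [signedIndicator, hA, hB] at h1 h2 ⊢ <;> linarith
  · intro i
    refine ⟨fun x y h => ?_, fun x y h => ?_⟩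
    · rw [(DiscreteSubsets.le_iff x y).1 h]
    · have e := (DiscreteSubsets.le_iff x y).1 h.le
      subst e
      exact absurd h (lt_irrefl _)
  · rintro ⟨f, -, hf⟩
    refine Function.cantor_injective (fun A : Set ℝ => f ⟨A⟩) ?_
    intro A B h
    have e := (DiscreteSubsets.le_iff _ _).1 (hf _ _ h).1
    exact congrArg DiscreteSubsets.carrier e
end

section
/- There exists a preordered space (X, ≼) which admits a multi-utility indexed by a set of cardinality 𝔠 (the cardinality of the continuum) but admits no strict monotone. -/
/-- There is a preordered space which admits a multi-utility indexed by
a set of cardinality 𝔠, but no strict monotone. -/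
theorem stmt_6 : ∃ (X : Type) (_ : Preorder X),
    (∃ (I : Type) (v : I → X → ℝ), Cardinal.mk I = Cardinal.continuum ∧
      IsMultiUtility v) ∧
    ¬ ∃ f : X → ℝ, IsStrictMonotoneFn f := by
  classical
  refine ⟨Set ℝ, inferInstance, ⟨ℝ, fun r s => if r ∈ s then 1 else 0, Cardinal.mk_real, ?_⟩, ?_⟩
  · intro s t
    constructor
    · intro h r
      by_cases hs : r ∈ s
      · have ht : r ∈ t := h hs
        simp [hs, ht]
      · by_cases ht : r ∈ t <;> simp [hs, ht]
    · intro h r hs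
      by_contra ht
      have h1 := h r
      simp only [hs, ht, if_true, if_false] at h1
      linarith
  · rintro ⟨f, hm, hf⟩
    have hq : ∀ a : ℝ, ∃ q : ℚ, f (Set.Iio a) < q ∧ (q : ℝ) < f (Set.Iic a) := fun a =>
      exists_rat_btwn (hf _ _ Set.Iio_ssubset_Iic_self)
    choose q hq1 hq2 using hq
    have hmono : StrictMono q := by
      intro a c hac
      have h1 : f (Set.Iic a) ≤ f (Set.Iio c) := hm _ _ (Set.Iic_subset_Iio.2 hac)
      have h2 : (q a : ℝ) < q c := by linarith [hq2 a, hq1 c]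
      exact_mod_cast h2
    have hc : Countable ℝ := hmono.injective.countable
    exact Cardinal.not_countable_real (Set.countable_univ)
end

section
/- There exists a preordered space (X, ≼) such that the quotient X/∼ has cardinality 𝔠 and ≼ admits no strict monotone multi-utility indexed by a set of cardinality 𝔠. -/
/-- There is a preordered space whose quotient `X/∼` (the
antisymmetrization) has cardinality 𝔠 and which admits no strict monotone
multi-utility indexed by a set of cardinality 𝔠. -/
theorem stmt_7 : ∃ (X : Type) (_ : Preorder X),
    Cardinal.mk (Antisymmetrization X (· ≤ ·)) = Cardinal.continuum ∧
    ¬ ∃ (I : Type) (v : I → X → ℝ), Cardinal.mk I = Cardinal.continuum ∧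
      IsMultiUtility v ∧ ∀ i, IsStrictMonotoneFn (v i) := by
  refine ⟨ℝ ×ₗ Bool, inferInstance, ?_, ?_⟩
  · have hb : Function.Bijective
        (toAntisymmetrization (α := ℝ ×ₗ Bool) (· ≤ ·)) := by
      constructor
      · intro a b h
        have h2 : AntisymmRel (· ≤ ·) a b := Quotient.exact h
        exact le_antisymm h2.1 h2.2
      · intro q
        induction q using Quotient.inductionOn with
        | _ a => exact ⟨a, rfl⟩
    rw [← Cardinal.mk_congr (Equiv.ofBijective _ hb), Cardinal.mk_congr (ofLex (α := ℝ × Bool))]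
    rw [Cardinal.mk_prod, Cardinal.mk_real]
    simp
  · rintro ⟨I, v, hI, -, hs⟩
    have hne : Nonempty I := by
      rw [← Cardinal.mk_ne_zero_iff, hI]
      exact Cardinal.continuum_ne_zero
    obtain ⟨i⟩ := hne
    have hf := (hs i).2
    have h1 : ∀ x : ℝ, ∃ q : ℚ, v i (toLex (x, false)) < q ∧ (q : ℝ) < v i (toLex (x, true)) := by
      intro x
      apply exists_rat_btwn
      apply hf
      rw [Prod.Lex.toLex_lt_toLex]
      right
      simp
    choose q hq1 hq2 using h1
    have hq : StrictMono q := by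
      intro x y hxy
      have h3 : v i (toLex (x, true)) < v i (toLex (y, false)) := by
        apply hf
        rw [Prod.Lex.toLex_lt_toLex]
        left
        exact hxy
      have h4 : (q x : ℝ) < q y := ((hq2 x).trans h3).trans (hq1 y)
      exact_mod_cast h4
    have hc : Countable ℝ := hq.injective.countable
    exact not_countable hc
end

section
/- Let (X, ≼) be a preordered space and let I be an infinite set. If there exists a multi-utility for ≼ indexed by I, then the cardinality of the quotient X/∼ is at most the cardinality of the power set of I, i.e., |X/∼| ≤ 2^|I|. -/
universe u

/-- If a preordered space has a multi-utility indexed by an infinite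
set `I`, then the quotient `X/∼` (the antisymmetrization) has cardinality at most
`2 ^ |I|`, the cardinality of the power set of `I`. -/
theorem stmt_8 {X : Type u} {I : Type u} [Preorder X] [Infinite I]
    (h : ∃ v : I → X → ℝ, IsMultiUtility v) :
    Cardinal.mk (Antisymmetrization X (· ≤ ·)) ≤ 2 ^ Cardinal.mk I := by
  obtain ⟨v, hv⟩ := h
  have hinj : Function.Injective (fun (q : Antisymmetrization X (· ≤ ·)) (i : I) =>
      (ULift.up (v i (ofAntisymmetrization (· ≤ ·) q)) : ULift.{u} ℝ)) := by
    intro p q hpq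
    have e : ∀ i, v i (ofAntisymmetrization (· ≤ ·) p) = v i (ofAntisymmetrization (· ≤ ·) q) :=
      fun i => congrArg ULift.down (congrFun hpq i)
    rw [← toAntisymmetrization_ofAntisymmetrization (· ≤ ·) p,
      ← toAntisymmetrization_ofAntisymmetrization (· ≤ ·) q]
    exact Quotient.sound ⟨(hv _ _).2 fun i => (e i).le, (hv _ _).2 fun i => (e i).ge⟩
  refine (Cardinal.mk_le_of_injective hinj).trans (le_of_eq ?_)
  rw [← Cardinal.power_def, Cardinal.mk_uLift, Cardinal.mk_real, Cardinal.lift_continuum,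
    ← Cardinal.two_power_aleph0, ← Cardinal.power_mul,
    Cardinal.aleph0_mul_eq (Cardinal.aleph0_le_mk I)]
end

section
/- For every infinite set I there exists a preordered space (X, ≼) which admits a multi-utility indexed by I and whose quotient X/∼ has cardinality exactly 2^|I|; in particular, the power set of I ordered by set inclusion is such a space. Hence the bound |X/∼| ≤ 2^|I| for preordered spaces with a multi-utility indexed by I cannot be improved. -/
universe u

/-- For every infinite set `I`, the power set of `I` ordered by set
inclusion (`Set I` with `≤` = `⊆`) is a preordered space admitting a multi-utility
indexed by `I` whose quotient `X/∼` has cardinality exactly `2 ^ |I|`. In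
particular, there exists such a preordered space, so the bound `|X/∼| ≤ 2 ^ |I|`
for preordered spaces with a multi-utility indexed by `I` cannot be improved. -/
theorem stmt_9 (I : Type u) [Infinite I] :
    ((∃ v : I → Set I → ℝ, IsMultiUtility v) ∧
      Cardinal.mk (Antisymmetrization (Set I) (· ≤ ·)) = 2 ^ Cardinal.mk I) ∧
    ∃ (X : Type u) (_ : Preorder X),
      (∃ v : I → X → ℝ, IsMultiUtility v) ∧
      Cardinal.mk (Antisymmetrization X (· ≤ ·)) = 2 ^ Cardinal.mk I := by
  have key : (∃ v : I → Set I → ℝ, IsMultiUtility v) ∧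
      Cardinal.mk (Antisymmetrization (Set I) (· ≤ ·)) = 2 ^ Cardinal.mk I := by
    classical
    refine ⟨⟨fun i s => if i ∈ s then 1 else 0, ?_⟩, ?_⟩
    · intro x y
      constructor
      · intro h i
        by_cases hx : i ∈ x
        · have hy : i ∈ y := h hx
          simp [hx, hy]
        · by_cases hy : i ∈ y <;> simp [hx, hy]
      · intro h i hx
        by_contra hy
        have h1 := h i
        simp only [hx, hy, if_true, if_false] at h1
        linarith
    · rw [← Cardinal.mk_set]
      refine (Cardinal.mk_congr (Equiv.ofBijective
        (toAntisymmetrization (α := Set I) (· ≤ ·)) ⟨?_, ?_⟩)).symm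
      · intro a b hab
        have h := Quotient.exact hab
        exact le_antisymm h.1 h.2
      · intro q
        exact Quotient.exists_rep q
  exact ⟨key, Set I, inferInstance, key⟩
end

section
/- Let (X, ≼) be a preordered space and let Z ⊆ X be a Debreu upper dense subset. Then every antichain A ⊆ X satisfies |A| ≤ 2^|Z|; in particular, the width of (X, ≼) is at most the cardinality of the power set of Z. -/
universe u

/-- A subset `Z ⊆ X` is Debreu upper dense if whenever `x ⋈ y` there is `z ∈ Z`
with `x ⋈ z` and `z ≼ y`. -/
def DebreuUpperDense {X : Type*} [Preorder X] (Z : Set X) : Prop :=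
  ∀ x y : X, Incomp x y → ∃ z ∈ Z, Incomp x z ∧ z ≤ y

/-- If `Z` is a Debreu upper dense subset of a preordered space `X`,
then every antichain `A ⊆ X` (any two distinct elements incomparable) satisfies
`|A| ≤ 2 ^ |Z|`; in particular the width of `(X, ≼)` is at most the cardinality of
the power set of `Z`. -/
theorem stmt_11 {X : Type u} [Preorder X] (Z : Set X) (hZ : DebreuUpperDense Z)
    (A : Set X) (hA : ∀ x ∈ A, ∀ y ∈ A, x ≠ y → Incomp x y) :
    Cardinal.mk A ≤ 2 ^ Cardinal.mk Z := by
  rw [← Cardinal.mk_set]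
  refine Cardinal.mk_le_of_injective (f := fun a : A => {z : Z | (z : X) ≤ (a : X)}) ?_
  intro a b hab
  by_contra hne
  obtain ⟨z, hz, hinc, hle⟩ :=
    hZ a b (hA a a.2 b b.2 (fun h => hne (Subtype.ext h)))
  have hmem : (⟨z, hz⟩ : Z) ∈ {w : Z | (w : X) ≤ (b : X)} := hle
  have hmem2 : (⟨z, hz⟩ : Z) ∈ {w : Z | (w : X) ≤ (a : X)} := by
    have h : {w : Z | (w : X) ≤ (a : X)} = {w : Z | (w : X) ≤ (b : X)} := hab
    rw [h]
    exact hmem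
  exact hinc.2 hmem2
end

section
/- For every uncountable set I there exists a preordered space (X, ≼) which admits a strict monotone but admits no multi-utility indexed by I. -/
universe u

/-- For every uncountable set `I` there is a preordered space which
admits a strict monotone but no multi-utility indexed by `I`. -/
theorem stmt_12 (I : Type u) [Uncountable I] :
    ∃ (X : Type u) (_ : Preorder X),
      (∃ f : X → ℝ, IsStrictMonotoneFn f) ∧
      ¬ ∃ v : I → X → ℝ, IsMultiUtility v := by
  let P : Preorder (Set I × Bool) :=
    { le := fun x y => x = y ∨ (x.2 = false ∧ y.2 = true ∧ x.1 ≠ y.1)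
      lt := fun x y => (x = y ∨ (x.2 = false ∧ y.2 = true ∧ x.1 ≠ y.1)) ∧
        ¬ (y = x ∨ (y.2 = false ∧ x.2 = true ∧ y.1 ≠ x.1))
      lt_iff_le_not_ge := fun _ _ => Iff.rfl
      le_refl := fun x => Or.inl rfl
      le_trans := by
        rintro x y z (rfl | ⟨h1, h2, h3⟩) (rfl | ⟨h4, h5, h6⟩)
        · exact Or.inl rfl
        · exact Or.inr ⟨h4, h5, h6⟩
        · exact Or.inr ⟨h1, h2, h3⟩
        · rw [h2] at h4; cases h4 }
  have hle : ∀ x y : Set I × Bool,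
      P.le x y ↔ (x = y ∨ (x.2 = false ∧ y.2 = true ∧ x.1 ≠ y.1)) := fun _ _ => Iff.rfl
  refine ⟨Set I × Bool, P, ⟨fun x => if x.2 = true then 1 else 0, ?_, ?_⟩, ?_⟩
  · intro x y h
    rcases (hle x y).1 h with rfl | ⟨h1, h2, -⟩
    · exact le_rfl
    · simp [h1, h2]
  · intro x y h
    rcases (hle x y).1 h.le with rfl | ⟨h1, h2, -⟩
    · exact absurd h (lt_irrefl _)
    · simp [h1, h2]
  · rintro ⟨v, hv⟩
    have key : ∀ s : Set I, ∃ i, v i (s, true) < v i (s, false) := by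
      intro s
      by_contra! hc
      rcases (hle _ _).1 ((hv (s, false) (s, true)).2 hc) with h | ⟨-, -, h⟩
      · simp at h
      · exact h rfl
    choose g hg using key
    refine Function.cantor_injective g ?_
    intro s t hst
    by_contra hne
    have h1 := (hv (s, false) (t, true)).1 ((hle _ _).2 (Or.inr ⟨rfl, rfl, hne⟩)) (g s)
    have h2 := (hv (t, false) (s, true)).1 ((hle _ _).2 (Or.inr ⟨rfl, rfl, Ne.symm hne⟩)) (g s)
    have h3 := hg s
    have h4 := hg t
    rw [← hst] at h4
    linarith
end

section
/- For every uncountable set I there exists a preordered space (X, ≼) which admits neither a multi-utility indexed by I nor a strict monotone. -/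
universe u

theorem no_mu (I : Type u) [Uncountable I] (X : Type u) [LinearOrder X] [WellFoundedLT X]
    [NoMaxOrder X] (hX : Cardinal.mk I < Cardinal.mk X) :
    ¬ ∃ v : I → X → ℝ, IsMultiUtility v := by
  rintro ⟨v, hv⟩
  letI : SuccOrder X := SuccOrder.ofLinearWellFoundedLT X
  have key : ∀ x : X, ∃ p : I × ℚ, v p.1 x < p.2 ∧ (p.2 : ℝ) < v p.1 (Order.succ x) := by
    intro x
    have h : ¬ Order.succ x ≤ x := not_le.mpr (Order.lt_succ x)
    rw [hv] at h
    push Not at h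
    obtain ⟨i, hi⟩ := h
    obtain ⟨q, h1, h2⟩ := exists_rat_btwn hi
    exact ⟨(i, q), h1, h2⟩
  choose g hg using key
  have aux : ∀ x y : X, x < y → g x ≠ g y := by
    intro x y hxy he
    have h1 := (hv _ _).1 (Order.succ_le_of_lt hxy) (g x).1
    have h2 := (hg x).2
    have h3 := (hg y).1
    rw [← he] at h3
    linarith
  have hinj : Function.Injective g := by
    intro x y he
    rcases lt_trichotomy x y with h | h | h
    · exact absurd he (aux _ _ h)
    · exact h
    · exact absurd he.symm (aux _ _ h)
  have hle := Cardinal.mk_le_of_injective hinj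
  have : Cardinal.mk (I × ℚ) = Cardinal.mk I := by
    simp
  rw [this] at hle
  exact absurd hX (not_lt.mpr hle)

/-- For every uncountable set `I` there is a preordered space which
admits neither a multi-utility indexed by `I` nor a strict monotone. -/
theorem stmt_13 (I : Type u) [Uncountable I] :
    ∃ (X : Type u) (_ : Preorder X),
      (¬ ∃ v : I → X → ℝ, IsMultiUtility v) ∧
      ¬ ∃ f : X → ℝ, IsStrictMonotoneFn f := by
  have hI : Cardinal.aleph0 ≤ Order.succ (Cardinal.mk I) :=
    (Cardinal.aleph0_le_mk I).trans (Order.le_succ _)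
  haveI := Cardinal.noMaxOrder hI
  have H := no_mu I (Order.succ (Cardinal.mk I)).ord.ToType
    (by rw [Cardinal.mk_ord_toType]; exact Order.lt_succ _)
  refine ⟨(Order.succ (Cardinal.mk I)).ord.ToType, inferInstance, H, ?_⟩
  rintro ⟨f, hf, hs⟩
  obtain ⟨i⟩ : Nonempty I := inferInstance
  refine H ⟨fun _ => f, fun x y => ⟨fun h _ => hf x y h, fun h => ?_⟩⟩
  by_contra hn
  exact absurd (h i) (not_le.mpr (hs _ _ (not_le.mp hn)))
end

section
/- For every uncountable set I there exists a preordered space (X, ≼) which admits a multi-utility indexed by a set of cardinality 2^|I|, but admits neither a strict monotone nor a multi-utility indexed by I. -/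
universe u

/-- For every uncountable set `I` there is a preordered space which
admits a multi-utility indexed by a set of cardinality `2 ^ |I|`, but admits
neither a strict monotone nor a multi-utility indexed by `I`. -/
theorem stmt_14 (I : Type u) [Uncountable I] :
    ∃ (X : Type u) (_ : Preorder X),
      (∃ (J : Type u) (w : J → X → ℝ),
        Cardinal.mk J = 2 ^ Cardinal.mk I ∧ IsMultiUtility w) ∧
      (¬ ∃ f : X → ℝ, IsStrictMonotoneFn f) ∧
      ¬ ∃ v : I → X → ℝ, IsMultiUtility v := by
  classical
  refine ⟨Set (Set I), inferInstance, ⟨Set I, fun j x => if j ∈ x then 1 else 0, ?_, ?_⟩, ?_, ?_⟩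
  · exact Cardinal.mk_set
  · intro x y
    constructor
    · intro h j
      by_cases hx : j ∈ x
      · simp [hx, h hx]
      · simp only [hx, if_false]
        split_ifs <;> norm_num
    · intro h j hx
      by_contra hy
      have := h j
      simp only [hx, hy, if_true, if_false] at this
      norm_num at this
  · rintro ⟨f, hm, hs⟩
    let r : Set I → Set I → Prop := WellOrderingRel
    have hlt : ∀ j, f {k | r k j} < f {k | r k j ∨ k = j} := by
      intro j
      apply hs
      refine ⟨fun k hk => Or.inl hk, fun h => ?_⟩
      have : r j j := h (Or.inr rfl)
      exact irrefl_of WellOrderingRel j this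
    choose q hq1 hq2 using fun j => exists_rat_btwn (hlt j)
    have hmono : ∀ a b, r a b → q a < q b := by
      intro a b hab
      have h1 : f {k | r k a ∨ k = a} ≤ f {k | r k b} := by
        apply hm
        rintro k (hk | rfl)
        · exact trans_of WellOrderingRel hk hab
        · exact hab
      exact_mod_cast (hq2 a).trans_le (h1.trans (hq1 b).le)
    have hinj : Function.Injective q := by
      intro a b hab
      rcases trichotomous_of WellOrderingRel a b with h | h | h
      · exact absurd hab (hmono a b h).ne
      · exact h
      · exact absurd hab (hmono b a h).ne'
    have hc : Countable (Set I) := hinj.countable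
    have : Countable I := (Set.singleton_injective (α := I)).countable
    exact not_countable (α := I) this
  · rintro ⟨v, hv⟩
    have hI : Nonempty (I × ℚ ≃ I) := by
      apply Cardinal.eq.1
      have h : Cardinal.aleph0 ≤ Cardinal.mk I := Cardinal.aleph0_le_mk I
      rw [Cardinal.mk_prod]
      simp [h]
    obtain ⟨e⟩ := hI
    let g : Set (Set I) → Set I := fun x => Set.image e {p : I × ℚ | (p.2 : ℝ) < v p.1 x}
    apply Function.cantor_injective g
    have key : ∀ x y, g x = g y → x ≤ y := by
      intro x y h
      have hh := e.injective.image_injective h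
      rw [hv]
      intro i
      by_contra hlt
      obtain ⟨q, h1, h2⟩ := exists_rat_btwn (not_le.1 hlt)
      have h3 : (i, q) ∈ {p : I × ℚ | (p.2 : ℝ) < v p.1 x} := h2
      rw [hh] at h3
      exact lt_asymm h1 h3
    intro x y h
    exact le_antisymm (key x y h) (key y x h.symm)
end

section
/- For every uncountable set I there exists a preordered space (X, ≼) such that the quotient X/∼ has cardinality strictly greater than |I|, ≼ admits a multi-utility indexed by I, and ≼ admits no strict monotone. -/
universe u

/-- For every uncountable set `I` there is a preordered space whose
quotient `X/∼` (the antisymmetrization) has cardinality strictly greater than `|I|`,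
which admits a multi-utility indexed by `I` but no strict monotone. -/
theorem stmt_15 (I : Type u) [Uncountable I] :
    ∃ (X : Type u) (_ : Preorder X),
      Cardinal.mk I < Cardinal.mk (Antisymmetrization X (· ≤ ·)) ∧
      (∃ v : I → X → ℝ, IsMultiUtility v) ∧
      ¬ ∃ f : X → ℝ, IsStrictMonotoneFn f := by
  classical
  refine ⟨Set I, inferInstance, ?_, ⟨fun i s => if i ∈ s then 1 else 0, ?_⟩, ?_⟩
  · have hinj : Function.Injective
        (fun s : Set I => toAntisymmetrization (α := Set I) (· ≤ ·) s) := by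
      intro s t h
      have h2 : AntisymmRel (· ≤ ·) s t := Quotient.exact h
      exact le_antisymm h2.1 h2.2
    refine lt_of_lt_of_le ?_ (Cardinal.mk_le_of_injective hinj)
    rw [Cardinal.mk_set]
    exact Cardinal.cantor _
  · intro s t
    constructor
    · intro h i
      by_cases hs : i ∈ s
      · have ht : i ∈ t := h hs
        simp [hs, ht]
      · by_cases ht : i ∈ t <;> simp [hs, ht]
    · intro h i hs
      by_contra ht
      have h1 := h i
      simp only [if_pos hs, if_neg ht] at h1
      linarith
  · rintro ⟨f, hm, hf⟩
    letI : LinearOrder I := linearOrderOfSTO (WellOrderingRel (α := I))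
    have hlt : ∀ i : I, f (Set.Iio i) < f (Set.Iic i) := fun i =>
      hf _ _ (Set.ssubset_iff_of_subset Set.Iio_subset_Iic_self |>.2 ⟨i, le_refl i, lt_irrefl i⟩)
    choose q hq1 hq2 using fun i => exists_rat_btwn (hlt i)
    have hq : StrictMono q := by
      intro i j hij
      have h1 : f (Set.Iic i) ≤ f (Set.Iio j) := hm _ _ (fun k hk => lt_of_le_of_lt hk hij)
      have h2 : (q i : ℝ) < q j := (hq2 i).trans (h1.trans_lt (hq1 j))
      exact_mod_cast h2
    exact not_countable (hq.injective.countable)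
end

section
/- There exists a preordered space (X, ≼) such that the quotient X/∼ is countably infinite and ≼ admits no finite multi-utility; in particular, the set X = ℤ∖{0} with the preorder defined by n ≼ m iff (n = m) or (n > 0, m < 0 and n ≠ −m) has this property. -/
/-- The ground set `ℤ ∖ {0}`. -/
structure ZeroFreeInt : Type where
  val : ℤ
  ne_zero : val ≠ 0

/-- The preorder on `ℤ ∖ {0}`: `n ≼ m` iff `n = m`, or `n > 0`, `m < 0` and `n ≠ -m`. -/
instance : Preorder ZeroFreeInt where
  le n m := n = m ∨ (0 < n.val ∧ m.val < 0 ∧ n.val ≠ -m.val)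
  le_refl n := Or.inl rfl
  le_trans := by
    rintro a b c (rfl | ⟨ha, hb, hne⟩) hbc
    · exact hbc
    · rcases hbc with rfl | ⟨hb', _, _⟩
      · exact Or.inr ⟨ha, hb, hne⟩
      · exact absurd hb' (not_lt.mpr hb.le)

theorem zfi_le_iff (n m : ZeroFreeInt) :
    n ≤ m ↔ n = m ∨ (0 < n.val ∧ m.val < 0 ∧ n.val ≠ -m.val) := Iff.rfl

theorem zfi_main : Countable (Antisymmetrization ZeroFreeInt (· ≤ ·)) ∧
      Infinite (Antisymmetrization ZeroFreeInt (· ≤ ·)) ∧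
      ¬ ∃ (N : ℕ) (v : Fin N → ZeroFreeInt → ℝ), IsMultiUtility v := by
  have hinj : Function.Injective ZeroFreeInt.val := by
    rintro ⟨a, ha⟩ ⟨b, hb⟩ h
    simpa using h
  have hc : Countable ZeroFreeInt := hinj.countable
  let p : ℕ → ZeroFreeInt := fun k => ⟨(k : ℤ) + 1, by omega⟩
  let q : ℕ → ZeroFreeInt := fun k => ⟨-((k : ℤ) + 1), by omega⟩
  have hpv : ∀ k, (p k).val = (k : ℤ) + 1 := fun k => rfl
  have hqv : ∀ k, (q k).val = -((k : ℤ) + 1) := fun k => rfl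
  have hpq : ∀ k l, k ≠ l → p k ≤ q l := by
    intro k l hkl
    rw [zfi_le_iff, hpv, hqv]
    right
    omega
  have hnpq : ∀ k, ¬ p k ≤ q k := by
    intro k h
    rw [zfi_le_iff, hpv, hqv] at h
    rcases h with h | h
    · have := congrArg ZeroFreeInt.val h
      rw [hpv, hqv] at this
      omega
    · omega
  refine ⟨?_, ?_, ?_⟩
  · exact Quotient.countable
  · refine Infinite.of_injective (fun k => toAntisymmetrization (· ≤ ·) (p k)) ?_
    intro k l h
    have h1 : p k ≤ p l := (Quotient.exact h).1
    rw [zfi_le_iff] at h1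
    rcases h1 with h1 | h1
    · have := congrArg ZeroFreeInt.val h1
      rw [hpv, hpv] at this
      omega
    · rw [hpv, hpv] at h1
      omega
  · rintro ⟨N, v, hv⟩
    have hex : ∀ k, ∃ i, v i (q k) < v i (p k) := by
      intro k
      have := hnpq k
      rw [hv] at this
      push Not at this
      exact this
    choose f hf using hex
    obtain ⟨k, l, hkl, hfe⟩ := Finite.exists_ne_map_eq_of_infinite f
    have h1 := hf k
    have h2 := hf l
    rw [← hfe] at h2
    have h3 := (hv _ _).1 (hpq k l hkl) (f k)
    have h4 := (hv _ _).1 (hpq l k hkl.symm) (f k)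
    linarith

/-- The set `X = ℤ ∖ {0}` with the preorder `n ≼ m` iff `n = m` or
(`n > 0`, `m < 0` and `n ≠ -m`) has a countably infinite quotient `X/∼` (the
antisymmetrization) and admits no finite multi-utility. In particular, a preordered
space with countably infinite quotient and no finite multi-utility exists. -/
theorem stmt_16 :
    (Countable (Antisymmetrization ZeroFreeInt (· ≤ ·)) ∧
      Infinite (Antisymmetrization ZeroFreeInt (· ≤ ·)) ∧
      ¬ ∃ (N : ℕ) (v : Fin N → ZeroFreeInt → ℝ), IsMultiUtility v) ∧
    ∃ (X : Type) (_ : Preorder X),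
      Countable (Antisymmetrization X (· ≤ ·)) ∧
      Infinite (Antisymmetrization X (· ≤ ·)) ∧
      ¬ ∃ (N : ℕ) (v : Fin N → X → ℝ), IsMultiUtility v := by
  exact ⟨zfi_main, ZeroFreeInt, inferInstance, zfi_main⟩
end

section
/- There exists a preordered space (X, ≼) such that the quotient X/∼ is uncountable, ≼ admits a countable multi-utility, and ≼ admits no finite multi-utility; in particular, X = ℕ ∪ P_inf(ℕ) (where P_inf(ℕ) is the set of infinite subsets of ℕ) with the preorder x ≼ y iff x = y, or (x ∈ ℕ, y ∈ P_inf(ℕ) and x ∈ y), has this property. -/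
/-- The ground set `ℕ ∪ P_inf(ℕ)`: the disjoint union of `ℕ` and the set of
infinite subsets of `ℕ`. -/
structure NatOrInfSet : Type where
  val : ℕ ⊕ {s : Set ℕ // s.Infinite}

/-- The preorder: `x ≼ y` iff `x = y`, or `x ∈ ℕ`, `y ∈ P_inf(ℕ)` and `x ∈ y`. -/
instance : Preorder NatOrInfSet where
  le x y := x = y ∨ ∃ (n : ℕ) (s : {s : Set ℕ // s.Infinite}),
    x.val = Sum.inl n ∧ y.val = Sum.inr s ∧ n ∈ s.1
  le_refl x := Or.inl rfl
  le_trans := by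
    rintro x y z (rfl | ⟨n, s, hx, hy, hn⟩) hyz
    · exact hyz
    · rcases hyz with rfl | ⟨m, t, hy', hz, hm⟩
      · exact Or.inr ⟨n, s, hx, hy, hn⟩
      · rw [hy] at hy'
        exact absurd hy' (by simp)

theorem le_inl_inr (n : ℕ) (s : {s : Set ℕ // s.Infinite}) :
    (⟨Sum.inl n⟩ : NatOrInfSet) ≤ ⟨Sum.inr s⟩ ↔ n ∈ s.1 := by
  constructor
  · rintro (h | ⟨m, t, h1, h2, h3⟩)
    · simp at h
    · simp only [Sum.inl.injEq, Sum.inr.injEq] at h1 h2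
      subst h1; subst h2; exact h3
  · intro h
    exact Or.inr ⟨n, s, rfl, rfl, h⟩

theorem le_inl_inl (n m : ℕ) :
    (⟨Sum.inl n⟩ : NatOrInfSet) ≤ ⟨Sum.inl m⟩ ↔ n = m := by
  constructor
  · rintro (h | ⟨k, t, h1, h2, h3⟩)
    · simpa using h
    · simp at h2
  · rintro rfl
    exact le_refl _

theorem le_inr (s : {s : Set ℕ // s.Infinite}) (y : NatOrInfSet) :
    (⟨Sum.inr s⟩ : NatOrInfSet) ≤ y ↔ y = ⟨Sum.inr s⟩ := by
  constructor
  · rintro (h | ⟨k, t, h1, h2, h3⟩)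
    · exact h.symm
    · simp at h1
  · rintro rfl
    exact le_refl _

theorem unc_aux : Uncountable (Antisymmetrization NatOrInfSet (· ≤ ·)) := by
  have hinf : ∀ S : Set ℕ, ({k | k % 2 = 1 ∨ k / 2 ∈ S} : Set ℕ).Infinite := by
    intro S
    refine Set.infinite_of_injective_forall_mem (f := fun n : ℕ => 2 * n + 1) ?_ ?_
    · intro a b h
      simp only at h
      omega
    · intro a
      left
      omega
  let f : Set ℕ → Antisymmetrization NatOrInfSet (· ≤ ·) := fun S =>
    toAntisymmetrization (· ≤ ·) ⟨Sum.inr ⟨_, hinf S⟩⟩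
  have hf : Function.Injective f := by
    intro S T h
    have h1 : AntisymmRel (· ≤ ·) (⟨Sum.inr ⟨_, hinf S⟩⟩ : NatOrInfSet)
        ⟨Sum.inr ⟨_, hinf T⟩⟩ := Quotient.exact h
    have h2 := (le_inr _ _).1 h1.1
    simp only [NatOrInfSet.mk.injEq, Sum.inr.injEq, Subtype.mk.injEq] at h2
    ext n
    have h3 := Set.ext_iff.1 h2 (2 * n)
    simp only [Set.mem_ofPred_eq] at h3
    have e1 : 2 * n % 2 = 0 := by omega
    have e2 : 2 * n / 2 = n := by omega
    rw [e1, e2] at h3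
    simp at h3
    exact h3.symm
  have hS : Uncountable (Set ℕ) := by
    rw [← not_countable_iff]
    intro hc
    obtain ⟨g, hg⟩ := exists_surjective_nat (Set ℕ)
    exact Function.cantor_surjective g hg
  exact hf.uncountable

open Classical in
theorem countable_aux : ∃ v : ℕ → NatOrInfSet → ℝ, IsMultiUtility v := by
  let a : ℕ → NatOrInfSet → ℝ := fun n x => if (⟨Sum.inl n⟩ : NatOrInfSet) ≤ x then 1 else 0
  let b : ℕ → NatOrInfSet → ℝ := fun n x =>
    if ∃ s : {s : Set ℕ // s.Infinite}, x = ⟨Sum.inr s⟩ ∧ n ∉ s.1 then 1 else 0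
  refine ⟨fun k => if k % 2 = 0 then a (k / 2) else b (k / 2), ?_⟩
  intro x y
  constructor
  · intro h k
    by_cases hk : k % 2 = 0
    · simp only [hk, if_true, a]
      split_ifs with h1 h2
      · exact le_refl _
      · exact absurd (h1.trans h) h2
      · exact zero_le_one
      · exact le_refl _
    · simp only [hk, if_false, b]
      split_ifs with h1 h2 h2
      · exact le_refl _
      · obtain ⟨s, rfl, hs⟩ := h1
        exact absurd ⟨s, (le_inr _ _).1 h, hs⟩ h2
      · exact zero_le_one
      · exact le_refl _
  · intro h
    have ha : ∀ n, (⟨Sum.inl n⟩ : NatOrInfSet) ≤ x → (⟨Sum.inl n⟩ : NatOrInfSet) ≤ y := by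
      intro n hx
      by_contra hy
      have := h (2 * n)
      have e1 : 2 * n % 2 = 0 := by omega
      have e2 : 2 * n / 2 = n := by omega
      simp only [e1, e2, if_true, a, hx, hy, if_false] at this
      linarith
    have hb : ∀ n, (∃ s : {s : Set ℕ // s.Infinite}, x = ⟨Sum.inr s⟩ ∧ n ∉ s.1) →
        (∃ s : {s : Set ℕ // s.Infinite}, y = ⟨Sum.inr s⟩ ∧ n ∉ s.1) := by
      intro n hx
      by_contra hy
      have := h (2 * n + 1)
      have e1 : ¬ (2 * n + 1) % 2 = 0 := by omega
      have e2 : (2 * n + 1) / 2 = n := by omega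
      simp only [e1, e2, if_false, b] at this
      rw [if_pos hx, if_neg hy] at this
      linarith
    obtain ⟨n | s⟩ := x
    · exact ha n (le_refl _)
    · obtain ⟨m | t⟩ := y
      · exfalso
        obtain ⟨n, hn, hlt⟩ := s.2.exists_gt m
        have := (le_inl_inl _ _).1 (ha n ((le_inl_inr _ _).2 hn))
        omega
      · rw [le_inr]
        have : t = s := by
          apply Subtype.ext
          ext n
          constructor
          · intro hn
            by_contra hs
            obtain ⟨t', e, ht'⟩ := hb n ⟨s, rfl, hs⟩
            simp only [NatOrInfSet.mk.injEq, Sum.inr.injEq] at e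
            subst e
            exact ht' hn
          · intro hn
            exact (le_inl_inr _ _).1 (ha n ((le_inl_inr _ _).2 hn))
        rw [this]

theorem nofinite_aux : ¬ ∃ (N : ℕ) (v : Fin N → NatOrInfSet → ℝ), IsMultiUtility v := by
  rintro ⟨N, v, hv⟩
  have hmax : ∀ i : Fin N, ∃ t : Fin (N + 1), ∀ p : Fin (N + 1),
      v i ⟨Sum.inl p.1⟩ ≤ v i ⟨Sum.inl t.1⟩ := fun i =>
    Finite.exists_max (fun p : Fin (N + 1) => v i ⟨Sum.inl p.1⟩)
  choose t ht using hmax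
  have hns : ¬ Function.Surjective t := by
    intro hs
    have := Fintype.card_le_of_surjective t hs
    simp at this
  simp only [Function.Surjective, not_forall, not_exists] at hns
  obtain ⟨p, hp⟩ := hns
  have hA : ({p.1}ᶜ : Set ℕ).Infinite := (Set.finite_singleton p.1).infinite_compl
  have hle : (⟨Sum.inl p.1⟩ : NatOrInfSet) ≤ ⟨Sum.inr ⟨_, hA⟩⟩ := by
    rw [hv]
    intro i
    refine (ht i p).trans ?_
    refine (hv _ _).1 ((le_inl_inr _ _).2 ?_) i
    intro h
    exact hp i (Fin.ext h)
  exact (le_inl_inr _ _).1 hle rfl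

/-- The space `X = ℕ ∪ P_inf(ℕ)` with the preorder `x ≼ y` iff
`x = y` or (`x ∈ ℕ`, `y ∈ P_inf(ℕ)` and `x ∈ y`) has an uncountable quotient `X/∼`
(the antisymmetrization), admits a countable multi-utility, and admits no finite
multi-utility. In particular such a preordered space exists. -/
theorem stmt_17 :
    (Uncountable (Antisymmetrization NatOrInfSet (· ≤ ·)) ∧
      (∃ v : ℕ → NatOrInfSet → ℝ, IsMultiUtility v) ∧
      ¬ ∃ (N : ℕ) (v : Fin N → NatOrInfSet → ℝ), IsMultiUtility v) ∧
    ∃ (X : Type) (_ : Preorder X),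
      Uncountable (Antisymmetrization X (· ≤ ·)) ∧
      (∃ v : ℕ → X → ℝ, IsMultiUtility v) ∧
      ¬ ∃ (N : ℕ) (v : Fin N → X → ℝ), IsMultiUtility v := by
  exact ⟨⟨unc_aux, countable_aux, nofinite_aux⟩,
    NatOrInfSet, inferInstance, unc_aux, countable_aux, nofinite_aux⟩
end

section
/- Let (X, ≼) be a preordered space and let N be a natural number. The following are equivalent: (i) there exists a multi-utility (u_i)_{i≤N} with N elements such that for every i ≤ N the set I_{u_i} := { r ∈ ℝ : ∃ x, y ∈ X with u_i(x) = r, u_i(y) = r and ¬(x ∼ y) } is countable; (ii) there exists an injective monotone multi-utility (v_i)_{i≤N} with N elements. -/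
/-- The image of the non-injective set of `u`: the set of real values attained by two
non-equivalent elements. -/
def NonInjectiveImage {X : Type*} [Preorder X] (u : X → ℝ) : Set ℝ :=
  {r : ℝ | ∃ x y : X, u x = r ∧ u y = r ∧ ¬ (x ≤ y ∧ y ≤ x)}

theorem aux_weight (I : Set ℝ) (hI : I.Countable) :
    ∃ w : ℝ → ℝ, (∀ r, 0 ≤ w r) ∧ (∀ r ∈ I, 0 < w r) ∧ Summable w := by
  haveI : Countable I := hI.to_subtype
  haveI : Encodable I := Encodable.ofCountable I
  obtain ⟨e, he, c, hc, -⟩ := posSumOfEncodable (ε := 1) one_pos I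
  classical
  refine ⟨fun r => if h : r ∈ I then e ⟨r, h⟩ else 0, ?_, ?_, ?_⟩
  · intro r
    dsimp only
    split_ifs with h
    · exact (he _).le
    · exact le_rfl
  · intro r hr
    simp only [hr, dif_pos]
    exact he _
  · have h1 : Summable ((fun r => if h : r ∈ I then e ⟨r, h⟩ else 0) ∘ (Subtype.val : I → ℝ)) := by
      refine hc.summable.congr ?_
      rintro ⟨r, hr⟩
      simp [hr]
    refine (Subtype.val_injective.summable_iff ?_).1 h1
    intro r hr
    have : r ∉ I := by simpa using hr
    simp [this]

theorem aux_jump (w : ℝ → ℝ) (hw : ∀ r, 0 ≤ w r) (hs : Summable w) {s t : ℝ} (hst : s < t) :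
    (∑' r, (Set.Iio s).indicator w r) + w s ≤ ∑' r, (Set.Iio t).indicator w r := by
  classical
  have h1 : Summable ((Set.Iio s).indicator w) := hs.indicator _
  have h2 : HasSum (fun r => if r = s then w s else 0) (w s) := hasSum_ite_eq s (w s)
  rw [← h2.tsum_eq, ← h1.tsum_add h2.summable]
  refine Summable.tsum_le_tsum ?_ (h1.add h2.summable) (hs.indicator _)
  intro r
  have := hw r
  simp only [Set.indicator, Set.mem_Iio]
  split_ifs <;> first | (subst_vars; simp_all; done) | (exfalso; linarith) | (simp; linarith)

theorem aux_lex {X : Type*} [Preorder X] (u g : X → ℝ) (hu : IsMonotoneFn u)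
    (hg : IsMonotoneFn g) (hI : (NonInjectiveImage u).Countable) :
    ∃ v : X → ℝ, IsMonotoneFn v ∧ (∀ x y, u x < u y → v x < v y) ∧
      ∀ x y, v x = v y → (x ≤ y ∧ y ≤ x) ∨ (u x = u y ∧ g x = g y) := by
  obtain ⟨w, hw, hwI, hs⟩ := aux_weight _ hI
  set S : ℝ → ℝ := fun t => ∑' r, (Set.Iio t).indicator w r with hS
  have hjump : ∀ s t, s < t → S s + w s ≤ S t := fun s t h => aux_jump w hw hs h
  let v : X → ℝ := fun x => u x + S (u x) + w (u x) * Real.sigmoid (g x)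
  have hlt : ∀ x y, u x < u y → v x < v y := by
    intro x y h
    have h1 := hjump _ _ h
    have h2 : w (u x) * Real.sigmoid (g x) ≤ w (u x) :=
      mul_le_of_le_one_right (hw _) (Real.sigmoid_le_one _)
    have h3 : 0 ≤ w (u y) * Real.sigmoid (g y) :=
      mul_nonneg (hw _) (Real.sigmoid_nonneg _)
    simp only [v]
    linarith
  refine ⟨v, ?_, hlt, ?_⟩
  · intro x y hxy
    rcases (hu x y hxy).lt_or_eq with h | h
    · exact (hlt x y h).le
    · have := mul_le_mul_of_nonneg_left (Real.sigmoid_monotone (hg x y hxy)) (hw (u y))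
      simp only [v, h]
      linarith
  · intro x y hxy
    have hux : u x = u y := by
      rcases lt_trichotomy (u x) (u y) with h | h | h
      · exact absurd hxy (hlt _ _ h).ne
      · exact h
      · exact absurd hxy (hlt _ _ h).ne'
    by_cases hc : x ≤ y ∧ y ≤ x
    · exact Or.inl hc
    · right
      have hpos := hwI (u y) ⟨x, y, hux, rfl, hc⟩
      refine ⟨hux, ?_⟩
      simp only [v, hux] at hxy
      have h1 : w (u y) * Real.sigmoid (g x) = w (u y) * Real.sigmoid (g y) := by linarith
      exact Real.sigmoid_injective (mul_left_cancel₀ hpos.ne' h1)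

theorem aux_list {X : Type*} [Preorder X] {N : ℕ} (u : Fin N → X → ℝ)
    (hu : ∀ i, IsMonotoneFn (u i)) (hI : ∀ i, (NonInjectiveImage (u i)).Countable)
    (L : List (Fin N)) :
    ∃ g : X → ℝ, IsMonotoneFn g ∧
      ∀ x y, g x = g y → (x ≤ y ∧ y ≤ x) ∨ ∀ j ∈ L, u j x = u j y := by
  induction L with
  | nil => exact ⟨fun _ => 0, fun _ _ _ => le_rfl, fun _ _ _ => Or.inr (by simp)⟩
  | cons i L ih =>
    obtain ⟨g, hg, hgi⟩ := ih
    obtain ⟨v, hv, -, hvi⟩ := aux_lex (u i) g (hu i) hg (hI i)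
    refine ⟨v, hv, fun x y h => ?_⟩
    rcases hvi x y h with h | ⟨h1, h2⟩
    · exact Or.inl h
    · rcases hgi x y h2 with h | h
      · exact Or.inl h
      · right
        intro j hj
        rcases List.mem_cons.1 hj with rfl | hj
        · exact h1
        · exact h j hj

/-- For a preordered space `X` and `N : ℕ`, the following are
equivalent: (i) there is a multi-utility with `N` elements such that the image of the
non-injective set of each of its members is countable; (ii) there is an injective
monotone multi-utility with `N` elements. -/
theorem stmt_19 {X : Type*} [Preorder X] (N : ℕ) :
    (∃ u : Fin N → X → ℝ, IsMultiUtility u ∧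
      ∀ i, (NonInjectiveImage (u i)).Countable) ↔
    (∃ v : Fin N → X → ℝ, IsMultiUtility v ∧
      ∀ i, IsInjectiveMonotoneFn (v i)) := by
  constructor
  · rintro ⟨u, hu, hI⟩
    have hm : ∀ i, IsMonotoneFn (u i) := fun i x y h => (hu x y).1 h i
    obtain ⟨g, hg, hgi⟩ := aux_list u hm hI (List.finRange N)
    choose v hv hlt hvi using fun i => aux_lex (u i) g (hm i) hg (hI i)
    refine ⟨v, fun x y => ⟨fun h i => hv i x y h, fun h => ?_⟩, fun i => ⟨hv i, fun x y h => ?_⟩⟩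
    · refine (hu x y).2 fun i => ?_
      by_contra hc
      exact absurd (h i) (not_le.2 (hlt i y x (not_le.1 hc)))
    · rcases hvi i x y h with h | ⟨-, h⟩
      · exact h
      · rcases hgi x y h with h | h
        · exact h
        · exact ⟨(hu x y).2 fun j => (h j (List.mem_finRange j)).le,
            (hu y x).2 fun j => (h j (List.mem_finRange j)).ge⟩
  · rintro ⟨v, hv, hvi⟩
    refine ⟨v, hv, fun i => ?_⟩
    have : NonInjectiveImage (v i) = ∅ := by
      ext r
      simp only [Set.mem_empty_iff_false, iff_false]
      rintro ⟨x, y, hx, hy, hn⟩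
      exact hn ((hvi i).2 x y (hx.trans hy.symm))
    rw [this]
    exact Set.countable_empty
end
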